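/- Assume there exist τ* ≥ 1 with C_t = μ² for every t ≥ τ* (finite full mixing time) and B with Var(S_τ) ≤ B for every τ ≥ 0. Then for every 1 ≤ t ≤ τ*: ∑_{k=0}^{t−1} (k+1)·C_k + t·∑_{k=t}^{τ*−1} C_k = t·(τ* + 1/2)·μ² − E[(S_t)²]/2. (This is the linear system Y = M·X of the paper's Lemma 5.4 relating the 2-point time correlators C_0,…,C_{τ*−1} to the second moments of the integrated transport, with g(t) = t(τ*+1/2)μ² − E[(S_t)²]/2.) -/

import Mathlib

open Finset

/-- Expectation with respect to the stationary path measure of length `τ`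
(paths have `τ + 1` states). -/
noncomputable def pathE {S : Type*} [Fintype S] (P : S → S → ℝ) (pi : S → ℝ) (τ : ℕ)
    (f : (Fin (τ + 1) → S) → ℝ) : ℝ :=
  ∑ x : Fin (τ + 1) → S,
    (pi (x 0) * ∏ t : Fin τ, P (x t.castSucc) (x t.succ)) * f x

/-- Integrated transport `S_τ = ∑_{t=1}^{τ} u (x_{t-1}, x_t)` along a path. -/
noncomputable def intTrans {S : Type*} (u : S → S → ℝ) (τ : ℕ) (x : Fin (τ + 1) → S) : ℝ :=
  ∑ t : Fin τ, u (x t.castSucc) (x t.succ)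

/-- Stationary mean `μ = E[u (x₀, x₁)]`. -/
noncomputable def mu {S : Type*} [Fintype S] (P : S → S → ℝ) (pi : S → ℝ)
    (u : S → S → ℝ) : ℝ :=
  pathE P pi 1 fun x => u (x 0) (x 1)

/-- Time correlator `C_k = E[u (x₀, x₁) · u (x_{k+1}, x_{k+2})]`. -/
noncomputable def corr {S : Type*} [Fintype S] (P : S → S → ℝ) (pi : S → ℝ)
    (u : S → S → ℝ) (k : ℕ) : ℝ :=
  pathE P pi (k + 2) fun x =>
    u (x 0) (x 1) * u (x ⟨k + 1, by omega⟩) (x ⟨k + 2, by omega⟩)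

/-- Variance of the integrated transport `Var(S_τ)`. -/
noncomputable def varS {S : Type*} [Fintype S] (P : S → S → ℝ) (pi : S → ℝ)
    (u : S → S → ℝ) (τ : ℕ) : ℝ :=
  pathE P pi τ (fun x => (intTrans u τ x) ^ 2)
    - (pathE P pi τ (fun x => intTrans u τ x)) ^ 2

lemma intTrans_succ {S : Type*} (u : S → S → ℝ) (τ : ℕ) (x : Fin (τ + 2) → S) :
    intTrans u (τ + 1) x = u (x 0) (x 1) + intTrans u τ fun i => x i.succ :=
  Fin.sum_univ_succ _

lemma intTrans_castSucc {S : Type*} (u : S → S → ℝ) (τ : ℕ) (x : Fin (τ + 2) → S) :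
    intTrans u (τ + 1) x = (intTrans u τ fun i => x i.castSucc) +
      u (x (Fin.last τ).castSucc) (x (Fin.last (τ + 1))) :=
  Fin.sum_univ_castSucc _

section PathExpectation

variable {S : Type*} [Fintype S] {P : S → S → ℝ} {pi : S → ℝ}

lemma pathE_add (τ : ℕ) (f g : (Fin (τ + 1) → S) → ℝ) :
    pathE P pi τ (fun x => f x + g x) = pathE P pi τ f + pathE P pi τ g := by
  simp only [pathE, mul_add, Finset.sum_add_distrib]

lemma pathE_const_mul (τ : ℕ) (c : ℝ) (f : (Fin (τ + 1) → S) → ℝ) :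
    pathE P pi τ (fun x => c * f x) = c * pathE P pi τ f := by
  simp only [pathE, Finset.mul_sum]
  exact Finset.sum_congr rfl fun x _ => by ring

lemma pathE_nonneg (hP : ∀ r r', 0 ≤ P r r') (hpi : ∀ r, 0 ≤ pi r) (τ : ℕ)
    {f : (Fin (τ + 1) → S) → ℝ} (hf : ∀ x, 0 ≤ f x) : 0 ≤ pathE P pi τ f :=
  Finset.sum_nonneg fun x _ =>
    mul_nonneg (mul_nonneg (hpi _) (Finset.prod_nonneg fun _ _ => hP _ _)) (hf x)

/-- Forgetting the last state of a path. -/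
lemma pathE_castSucc (hProw : ∀ r, ∑ r', P r r' = 1) (τ : ℕ) (f : (Fin (τ + 1) → S) → ℝ) :
    pathE P pi (τ + 1) (fun x => f fun i => x i.castSucc) = pathE P pi τ f := by
  unfold pathE
  rw [← (Fin.snocEquiv fun _ : Fin (τ + 2) => S).sum_comp, Fintype.sum_prod_type_right]
  refine Finset.sum_congr rfl fun y _ => ?_
  have hzero : ∀ a : S, Fin.snoc (α := fun _ => S) y a (0 : Fin (τ + 2)) = y 0 := fun a =>
    Fin.snoc_castSucc (α := fun _ => S) a y 0
  simp only [Fin.snocEquiv_apply, Fin.prod_univ_castSucc, Fin.snoc_castSucc, hzero,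
    Fin.succ_last, Fin.snoc_last, ← Fin.castSucc_succ]
  rw [← Finset.sum_mul, ← Finset.mul_sum, ← Finset.mul_sum, hProw, mul_one]

/-- Forgetting the first state of a path. -/
lemma pathE_succ (hstat : ∀ r', ∑ r, pi r * P r r' = pi r') (τ : ℕ)
    (f : (Fin (τ + 1) → S) → ℝ) :
    pathE P pi (τ + 1) (fun x => f fun i => x i.succ) = pathE P pi τ f := by
  unfold pathE
  rw [← (Fin.consEquiv fun _ : Fin (τ + 2) => S).sum_comp, Fintype.sum_prod_type_right]
  refine Finset.sum_congr rfl fun y _ => ?_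
  simp only [Fin.consEquiv_apply, Fin.prod_univ_succ, Fin.castSucc_zero, Fin.cons_zero,
    Fin.cons_succ, ← Fin.succ_castSucc, ← mul_assoc]
  rw [← Finset.sum_mul, ← Finset.sum_mul, hstat]

lemma pathE_one (hProw : ∀ r, ∑ r', P r r' = 1) (hpisum : ∑ r, pi r = 1) (τ : ℕ) :
    pathE P pi τ (fun _ => 1) = 1 := by
  induction τ with
  | zero =>
    unfold pathE
    rw [← (Equiv.funUnique (Fin 1) S).symm.sum_comp]
    simpa using hpisum
  | succ τ ih => exact (pathE_castSucc hProw τ fun _ => 1).trans ih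

lemma pathE_first_step (hProw : ∀ r, ∑ r', P r r' = 1) (g : S → S → ℝ) (τ : ℕ) :
    pathE P pi (τ + 1) (fun x => g (x 0) (x 1)) = mu P pi g := by
  induction τ with
  | zero => rfl
  | succ τ ih => exact (pathE_castSucc hProw (τ + 1) fun x => g (x 0) (x 1)).trans ih

lemma sq_pathE_le (hP : ∀ r r', 0 ≤ P r r') (hpi : ∀ r, 0 ≤ pi r)
    (hProw : ∀ r, ∑ r', P r r' = 1) (hpisum : ∑ r, pi r = 1) (τ : ℕ)
    (f : (Fin (τ + 1) → S) → ℝ) :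
    pathE P pi τ f ^ 2 ≤ pathE P pi τ fun x => f x ^ 2 := by
  set m := pathE P pi τ f with hm
  have h : 0 ≤ pathE P pi τ (fun x => (f x - m) ^ 2) :=
    pathE_nonneg hP hpi τ fun _ => sq_nonneg _
  have e : (fun x => (f x - m) ^ 2) = fun x => (f x ^ 2 + (-2 * m) * f x) + m ^ 2 * 1 := by
    funext x; ring
  rw [e, pathE_add, pathE_add, pathE_const_mul, pathE_const_mul, ← hm,
    pathE_one hProw hpisum] at h
  linarith

lemma pathE_intTrans (hProw : ∀ r, ∑ r', P r r' = 1)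
    (hstat : ∀ r', ∑ r, pi r * P r r' = pi r') (u : S → S → ℝ) (τ : ℕ) :
    pathE P pi τ (fun x => intTrans u τ x) = τ * mu P pi u := by
  induction τ with
  | zero => simp [intTrans, pathE]
  | succ τ ih =>
    simp only [intTrans_succ]
    rw [pathE_add, pathE_first_step hProw, pathE_succ hstat τ (intTrans u τ)]
    rw [ih]
    push_cast
    ring

lemma pathE_first_step_mul_intTrans (hProw : ∀ r, ∑ r', P r r' = 1) (u : S → S → ℝ) (τ : ℕ) :
    pathE P pi (τ + 1) (fun x => u (x 0) (x 1) * intTrans u τ fun i => x i.succ) =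
      ∑ k ∈ Finset.range τ, corr P pi u k := by
  induction τ with
  | zero => simp [intTrans, pathE]
  | succ τ ih =>
    simp only [intTrans_castSucc u τ, mul_add]
    rw [pathE_add, Finset.sum_range_succ, ← ih]
    congr 1
    exact pathE_castSucc hProw (τ + 1)
      fun x => u (x 0) (x 1) * intTrans u τ fun i => x i.succ

lemma pathE_sq_intTrans_succ (hProw : ∀ r, ∑ r', P r r' = 1)
    (hstat : ∀ r', ∑ r, pi r * P r r' = pi r') (u : S → S → ℝ) (τ : ℕ) :
    pathE P pi (τ + 1) (fun x => intTrans u (τ + 1) x ^ 2) =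
      mu P pi (fun r r' => u r r' ^ 2) + 2 * ∑ k ∈ Finset.range τ, corr P pi u k
        + pathE P pi τ (fun x => intTrans u τ x ^ 2) := by
  have e : (fun x : Fin (τ + 2) → S => intTrans u (τ + 1) x ^ 2) = fun x =>
      (u (x 0) (x 1) ^ 2 + 2 * (u (x 0) (x 1) * intTrans u τ fun i => x i.succ))
        + (intTrans u τ fun i => x i.succ) ^ 2 := by
    funext x; rw [intTrans_succ]; ring
  rw [e, pathE_add, pathE_add, pathE_const_mul, pathE_first_step_mul_intTrans hProw,
    pathE_first_step hProw fun r r' => u r r' ^ 2,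
    pathE_succ hstat τ fun x => intTrans u τ x ^ 2]

end PathExpectation

/-- A bounded sequence cannot have constant nonzero increments. -/
lemma eq_zero_of_bounded_of_succ_eq_add {V : ℕ → ℝ} {a b s : ℝ} {N : ℕ}
    (ha : ∀ n, a ≤ V n) (hb : ∀ n, V n ≤ b) (hV : ∀ n, N ≤ n → V (n + 1) = V n + s) :
    s = 0 := by
  have hlin : ∀ n : ℕ, V (N + n) = V N + n * s := by
    intro n
    induction n with
    | zero => simp
    | succ n ih =>
      rw [← add_assoc, hV _ (Nat.le_add_right N n), ih]
      push_cast
      ring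
  by_contra hs
  obtain ⟨n, hn⟩ := exists_nat_gt ((b - a) / |s|)
  rw [div_lt_iff₀ (abs_pos.mpr hs), ← Nat.abs_cast n, ← abs_mul] at hn
  refine absurd hn (not_lt.mpr (abs_le.mpr ⟨?_, ?_⟩)) <;>
    linarith [hlin n, ha N, hb N, ha (N + n), hb (N + n)]

/-- The linear system `Y = M·X` of Lemma 5.4: under a finite full mixing time
(`C_t = μ²` for `t ≥ τ*`, `τ* ≥ 1`) and bounded variance of the integrated
transport, for every `1 ≤ t ≤ τ*`,
`∑_{k=0}^{t-1} (k+1) C_k + t ∑_{k=t}^{τ*-1} C_k = t (τ* + 1/2) μ² - E[(S_t)²]/2`. -/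
theorem linear_system_correlators
    {S : Type*} [Fintype S] [Nonempty S]
    (P : S → S → ℝ) (pi : S → ℝ) (u : S → S → ℝ)
    (hP : ∀ r r', 0 ≤ P r r') (hProw : ∀ r, ∑ r', P r r' = 1)
    (hpi : ∀ r, 0 ≤ pi r) (hpisum : ∑ r, pi r = 1)
    (hstat : ∀ r', ∑ r, pi r * P r r' = pi r')
    (τstar : ℕ) (hτstar : 1 ≤ τstar)
    (hmix : ∀ t, τstar ≤ t → corr P pi u t = (mu P pi u) ^ 2)
    (B : ℝ) (hB : ∀ τ : ℕ, varS P pi u τ ≤ B) :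
    ∀ t : ℕ, 1 ≤ t → t ≤ τstar →
      ∑ k ∈ Finset.range t, ((k : ℝ) + 1) * corr P pi u k
          + (t : ℝ) * ∑ k ∈ Finset.Ico t τstar, corr P pi u k =
        (t : ℝ) * ((τstar : ℝ) + 1 / 2) * (mu P pi u) ^ 2
          - pathE P pi t (fun x => (intTrans u t x) ^ 2) / 2 := by
  have hQ := pathE_sq_intTrans_succ (P := P) (pi := pi) hProw hstat u
  have hvar : ∀ τ : ℕ, varS P pi u τ =
      pathE P pi τ (fun x => intTrans u τ x ^ 2) - (τ * mu P pi u) ^ 2 := fun τ => by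
    rw [varS, pathE_intTrans hProw hstat]
  have hslope : mu P pi (fun r r' => u r r' ^ 2)
      + 2 * ∑ k ∈ Finset.range τstar, corr P pi u k
      - (2 * τstar + 1) * mu P pi u ^ 2 = 0 := by
    refine eq_zero_of_bounded_of_succ_eq_add (V := varS P pi u) (N := τstar)
      (fun τ => sub_nonneg.mpr (sq_pathE_le hP hpi hProw hpisum τ _)) hB fun n hn => ?_
    have hsum : ∑ k ∈ Finset.Ico τstar n, corr P pi u k =
        ((n : ℝ) - τstar) * mu P pi u ^ 2 := by
      rw [Finset.sum_congr rfl fun k hk => hmix k (Finset.mem_Ico.mp hk).1, Finset.sum_const,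
        Nat.card_Ico, nsmul_eq_mul, Nat.cast_sub hn]
    rw [hvar, hvar, hQ, ← Finset.sum_range_add_sum_Ico _ hn, hsum]
    push_cast
    ring
  intro t hpos ht
  clear hpos
  induction t with
  | zero => simp [intTrans, pathE]
  | succ t ih =>
    have ih := ih (Nat.le_of_succ_le ht)
    rw [Finset.sum_eq_sum_Ico_succ_bot ht] at ih
    rw [← Finset.sum_range_add_sum_Ico _ (Nat.le_of_succ_le ht),
      Finset.sum_eq_sum_Ico_succ_bot ht] at hslope
    rw [Finset.sum_range_succ, hQ]
    push_cast
    linarith
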